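/- Assume 0 ≤ R(s,a) ≤ 1 for all s, a, and let Q⋆ be the fixed point of the average Bellman operator T. Let E ≥ 1 be an integer with (1−γ)E ≥ 2, and assume (1−γ)² ≤ 16γ. Define the QAvg iterates with step sizes λ_t = 2/((1−γ)(t+E)): Q₀^k = Q₀ for all k, where Q₀ : S × A → ℝ takes values in [0, 1/(1−γ)]; for each t, set Q̃_{t+1}^k = (1−λ_t) Q_t^k + λ_t T_k Q_t^k, and let Q_{t+1}^k = (1/n) Σ_{j=1}^n Q̃_{t+1}^j if E divides t+1, and Q_{t+1}^k = Q̃_{t+1}^k otherwise. Write Q̄_t = (1/n) Σ_{k=1}^n Q_t^k. Then for every t ∈ ℕ, ‖Q̄_t − Q⋆‖∞ ≤ 16γE/((1−γ)³(t+E)). -/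

import Mathlib

open Finset

/-- The Bellman optimality operator of a finite Markov decision process. -/
noncomputable def bellman {S A : Type*} [Fintype S] [Fintype A] [Nonempty A] (γ : ℝ)
    (R : S → A → ℝ) (P : S → A → S → ℝ) (Q : S × A → ℝ) : S × A → ℝ := fun sa =>
  R sa.1 sa.2 + γ * ∑ s', P sa.1 sa.2 s' *
    (Finset.univ.sup' Finset.univ_nonempty fun a' => Q (s', a'))

section Bellman

variable {S A : Type*} [Fintype S] [Fintype A] [Nonempty A] {γ : ℝ}
  {R : S → A → ℝ} {P : S → A → S → ℝ}

lemma bellman_le_add (hγ : 0 ≤ γ) (hP : ∀ s a s', 0 ≤ P s a s')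
    (hP1 : ∀ s a, ∑ s', P s a s' = 1) {Q Q' : S × A → ℝ} {c : ℝ}
    (h : ∀ sa, Q sa ≤ Q' sa + c) (sa : S × A) :
    bellman γ R P Q sa ≤ bellman γ R P Q' sa + γ * c := by
  have hsup : ∀ s', (Finset.univ.sup' Finset.univ_nonempty fun a' => Q (s', a')) ≤
      (Finset.univ.sup' Finset.univ_nonempty fun a' => Q' (s', a')) + c := fun s' =>
    Finset.sup'_le _ _ fun a' _ => (h (s', a')).trans <| by
      gcongr
      exact Finset.le_sup' (fun a' => Q' (s', a')) (Finset.mem_univ a')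
  have hsum : ∑ s', P sa.1 sa.2 s' *
        (Finset.univ.sup' Finset.univ_nonempty fun a' => Q (s', a')) ≤
      ∑ s', P sa.1 sa.2 s' *
        (Finset.univ.sup' Finset.univ_nonempty fun a' => Q' (s', a')) + c := by
    calc _ ≤ ∑ s', P sa.1 sa.2 s' *
          ((Finset.univ.sup' Finset.univ_nonempty fun a' => Q' (s', a')) + c) :=
          Finset.sum_le_sum fun s' _ => mul_le_mul_of_nonneg_left (hsup s') (hP _ _ _)
      _ = _ := by simp only [mul_add, Finset.sum_add_distrib, ← Finset.sum_mul, hP1, one_mul]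
  have := mul_le_mul_of_nonneg_left hsum hγ
  simp only [bellman]
  linarith

lemma abs_bellman_sub_le (hγ : 0 ≤ γ) (hP : ∀ s a s', 0 ≤ P s a s')
    (hP1 : ∀ s a, ∑ s', P s a s' = 1) {Q Q' : S × A → ℝ} {c : ℝ}
    (h : ∀ sa, |Q sa - Q' sa| ≤ c) (sa : S × A) :
    |bellman γ R P Q sa - bellman γ R P Q' sa| ≤ γ * c := by
  have h₁ := bellman_le_add (R := R) hγ hP hP1 (Q := Q) (Q' := Q') (c := c)
    (fun sa => by linarith [(abs_le.1 (h sa)).2]) sa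
  have h₂ := bellman_le_add (R := R) hγ hP hP1 (Q := Q') (Q' := Q) (c := c)
    (fun sa => by linarith [(abs_le.1 (h sa)).1]) sa
  exact abs_le.2 ⟨by linarith, by linarith⟩

lemma bellman_zero (sa : S × A) : bellman γ R P 0 sa = R sa.1 sa.2 := by
  simp [bellman]

lemma bellman_le (hγ : 0 ≤ γ) (hP : ∀ s a s', 0 ≤ P s a s')
    (hP1 : ∀ s a, ∑ s', P s a s' = 1) (hR : ∀ s a, R s a ≤ 1) {Q : S × A → ℝ} {c : ℝ}
    (h : ∀ sa, Q sa ≤ c) (sa : S × A) : bellman γ R P Q sa ≤ 1 + γ * c := by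
  have := bellman_le_add (R := R) hγ hP hP1 (Q := Q) (Q' := 0) (c := c) (by simpa using h) sa
  rw [bellman_zero] at this
  linarith [hR sa.1 sa.2]

lemma le_bellman (hγ : 0 ≤ γ) (hP : ∀ s a s', 0 ≤ P s a s')
    (hP1 : ∀ s a, ∑ s', P s a s' = 1) (hR : ∀ s a, 0 ≤ R s a) {Q : S × A → ℝ} {c : ℝ}
    (h : ∀ sa, c ≤ Q sa) (sa : S × A) : γ * c ≤ bellman γ R P Q sa := by
  have := bellman_le_add (R := R) hγ hP hP1 (Q := 0) (Q' := Q) (c := -c)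
    (fun sa => by simpa using h sa) sa
  rw [bellman_zero] at this
  linarith [hR sa.1 sa.2]

lemma bellman_mem_Icc (hγ : 0 ≤ γ) (hγ1 : γ < 1) (hP : ∀ s a s', 0 ≤ P s a s')
    (hP1 : ∀ s a, ∑ s', P s a s' = 1) (hR0 : ∀ s a, 0 ≤ R s a) (hR1 : ∀ s a, R s a ≤ 1)
    {Q : S × A → ℝ} (h : ∀ sa, Q sa ∈ Set.Icc 0 (1 / (1 - γ))) (sa : S × A) :
    bellman γ R P Q sa ∈ Set.Icc 0 (1 / (1 - γ)) := by
  have h₁ := le_bellman hγ hP hP1 hR0 (fun sa => (h sa).1) sa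
  have h₂ := bellman_le hγ hP hP1 hR1 (fun sa => (h sa).2) sa
  have : 1 + γ * (1 / (1 - γ)) = 1 / (1 - γ) := by
    field_simp [(sub_pos.2 hγ1).ne']
    ring
  exact ⟨by linarith, by linarith⟩

end Bellman

lemma average_mem_Icc {n : ℕ} (hn : 1 ≤ n) {f : Fin n → ℝ} {a b : ℝ}
    (h : ∀ k, f k ∈ Set.Icc a b) : (1 / (n : ℝ)) * ∑ k, f k ∈ Set.Icc a b := by
  have hn0 : (0 : ℝ) < n := by exact_mod_cast hn
  have h₁ := Finset.card_nsmul_le_sum Finset.univ f a fun k _ => (h k).1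
  have h₂ := Finset.sum_le_card_nsmul Finset.univ f b fun k _ => (h k).2
  simp only [Finset.card_univ, Fintype.card_fin, nsmul_eq_mul] at h₁ h₂
  rw [one_div, inv_mul_eq_div]
  exact ⟨(le_div_iff₀ hn0).2 (by linarith), (div_le_iff₀ hn0).2 (by linarith)⟩

lemma abs_average_sub_le {n : ℕ} (hn : 1 ≤ n) {f : Fin n → ℝ} {x c : ℝ}
    (h : ∀ k, |f k - x| ≤ c) : |(1 / (n : ℝ)) * ∑ k, f k - x| ≤ c := by
  have := average_mem_Icc hn (f := f) (a := x - c) (b := x + c) fun k =>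
    ⟨by linarith [(abs_le.1 (h k)).1], by linarith [(abs_le.1 (h k)).2]⟩
  exact abs_le.2 ⟨by linarith [this.1], by linarith [this.2]⟩

/-- A fixed point of the average Bellman operator takes values in `[0, 1 / (1 - γ)]`. -/
lemma average_bellman_fixed_mem_Icc {S A : Type*} [Fintype S] [Fintype A] [Nonempty S]
    [Nonempty A] {γ : ℝ} (hγ : 0 ≤ γ) (hγ1 : γ < 1) {n : ℕ} (hn : 1 ≤ n)
    {R : S → A → ℝ} (hR0 : ∀ s a, 0 ≤ R s a) (hR1 : ∀ s a, R s a ≤ 1)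
    {P : Fin n → S → A → S → ℝ} (hP : ∀ k s a s', 0 ≤ P k s a s')
    (hP1 : ∀ k s a, ∑ s', P k s a s' = 1) {Q : S × A → ℝ}
    (hfix : ∀ sa, Q sa = (1 / (n : ℝ)) * ∑ k, bellman γ R (P k) Q sa) (sa : S × A) :
    Q sa ∈ Set.Icc 0 (1 / (1 - γ)) := by
  obtain ⟨x, hx⟩ := Finite.exists_min Q
  obtain ⟨y, hy⟩ := Finite.exists_max Q
  have hb : ∀ sa, Q sa ∈ Set.Icc (γ * Q x) (1 + γ * Q y) := fun sa => by
    rw [hfix sa]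
    exact average_mem_Icc hn fun k =>
      ⟨le_bellman hγ (hP k) (hP1 k) hR0 hx sa, bellman_le hγ (hP k) (hP1 k) hR1 hy sa⟩
  have hγ' := sub_pos.2 hγ1
  refine ⟨le_trans ?_ (hx sa), (hy sa).trans ?_⟩
  · nlinarith [(hb x).1]
  · rw [le_div_iff₀ hγ']
    linarith [(hb y).2]

lemma convex_combination_mem_Icc {l x y a b : ℝ} (hl0 : 0 ≤ l) (hl1 : l ≤ 1)
    (hx : x ∈ Set.Icc a b) (hy : y ∈ Set.Icc a b) : (1 - l) * x + l * y ∈ Set.Icc a b :=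
  convex_Icc a b hx hy (sub_nonneg.2 hl1) hl0 (by ring)

/-- Step sizes `2 / ((1 - γ) τ)` turn a contraction with perturbation `O(1 / τ)` into an
`O(1 / τ)` error bound. -/
lemma inverse_rate_step {γ τ E : ℝ} (hγ0 : 0 ≤ γ) (hγ1 : γ < 1) (hE : 0 ≤ E) (hτ : 0 < τ) :
    (1 - 2 / ((1 - γ) * τ)) * (16 * γ * E / ((1 - γ) ^ 3 * τ)) +
      2 / ((1 - γ) * τ) *
        (γ * (16 * γ * E / ((1 - γ) ^ 3 * τ) + 4 * E / ((1 - γ) ^ 2 * τ))) ≤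
      16 * γ * E / ((1 - γ) ^ 3 * (τ + 1)) := by
  have hg : 0 < 1 - γ := sub_pos.2 hγ1
  rw [← sub_nonneg]
  have key : 16 * γ * E / ((1 - γ) ^ 3 * (τ + 1)) -
      ((1 - 2 / ((1 - γ) * τ)) * (16 * γ * E / ((1 - γ) ^ 3 * τ)) +
      2 / ((1 - γ) * τ) *
        (γ * (16 * γ * E / ((1 - γ) ^ 3 * τ) + 4 * E / ((1 - γ) ^ 2 * τ)))) =
      8 * γ * E * (τ + 3) / ((1 - γ) ^ 3 * τ ^ 2 * (τ + 1)) := by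
    have := hg.ne'
    field_simp
    ring
  rw [key]
  positivity

/-- Convergence of QAvg. With rewards in `[0,1]`, `Q⋆` the fixed point of the
average Bellman operator, `E ≥ 1` with `(1−γ)E ≥ 2` and `(1−γ)² ≤ 16γ`, step sizes
`λ_t = 2/((1−γ)(t+E))`, and the QAvg iterates (local Bellman update with step `λ_t`,
aggregation every `E` steps, common initialization `Q₀` with values in `[0, 1/(1−γ)]`),
we have `‖Q̄_t − Q⋆‖∞ ≤ 16γE/((1−γ)³(t+E))` for every `t` (the norm on the finite pi
type `S × A → ℝ` is the maximum norm). -/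
theorem stmt_8 {S A : Type*} [Fintype S] [Fintype A] [Nonempty S] [Nonempty A]
    (γ : ℝ) (hγ0 : 0 ≤ γ) (hγ1 : γ < 1)
    (n : ℕ) (hn : 1 ≤ n)
    (R : S → A → ℝ) (hR0 : ∀ s a, 0 ≤ R s a) (hR1 : ∀ s a, R s a ≤ 1)
    (P : Fin n → S → A → S → ℝ)
    (hPpos : ∀ k s a s', 0 ≤ P k s a s')
    (hPsum : ∀ k s a, ∑ s', P k s a s' = 1)
    (Tk : Fin n → (S × A → ℝ) → (S × A → ℝ))
    (hTk : ∀ k Q sa, Tk k Q sa = R sa.1 sa.2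
        + γ * ∑ s', P k sa.1 sa.2 s' *
          (Finset.univ.sup' Finset.univ_nonempty fun a' => Q (s', a')))
    (Qstar : S × A → ℝ)
    (hfix : ∀ sa, Qstar sa = (1 / (n : ℝ)) * ∑ k, Tk k Qstar sa)
    (E : ℕ) (hE : 1 ≤ E) (hEγ : 2 ≤ (1 - γ) * E) (hγE : (1 - γ) ^ 2 ≤ 16 * γ)
    (lam : ℕ → ℝ) (hlam : ∀ t, lam t = 2 / ((1 - γ) * ((t : ℝ) + E)))
    (Q₀ : S × A → ℝ) (hQ₀ : ∀ sa, Q₀ sa ∈ Set.Icc (0 : ℝ) (1 / (1 - γ)))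
    (Q : ℕ → Fin n → S × A → ℝ)
    (hQinit : ∀ k, Q 0 k = Q₀)
    (hQupd : ∀ t k, Q (t + 1) k =
      if E ∣ (t + 1) then
        (1 / (n : ℝ)) • ∑ j, ((1 - lam t) • Q t j + lam t • Tk j (Q t j))
      else
        (1 - lam t) • Q t k + lam t • Tk k (Q t k))
    (Qbar : ℕ → S × A → ℝ) (hQbar : ∀ t, Qbar t = (1 / (n : ℝ)) • ∑ k, Q t k) :
    ∀ t, ‖Qbar t - Qstar‖ ≤ 16 * γ * E / ((1 - γ) ^ 3 * ((t : ℝ) + E)) := by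
  obtain rfl : Tk = fun k => bellman γ R (P k) := by
    funext k Q sa
    exact hTk k Q sa
  have hg : 0 < 1 - γ := sub_pos.2 hγ1
  have hE0 : (0 : ℝ) < E := by exact_mod_cast hE
  have hτ : ∀ t : ℕ, (0 : ℝ) < t + E := fun t => by positivity
  have hlam0 : ∀ t, 0 ≤ lam t := fun t => by
    rw [hlam]
    have := hτ t
    positivity
  have hlam1 : ∀ t, lam t ≤ 1 := fun t => by
    rw [hlam, div_le_one (mul_pos hg (hτ t))]
    nlinarith [mul_nonneg hg.le (Nat.cast_nonneg (α := ℝ) t)]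
  have hQrange : ∀ t k sa, Q t k sa ∈ Set.Icc 0 (1 / (1 - γ)) := by
    intro t
    induction t with
    | zero => exact fun k sa => hQinit k ▸ hQ₀ sa
    | succ t ih =>
      have hstep : ∀ k sa, (1 - lam t) * Q t k sa + lam t * bellman γ R (P k) (Q t k) sa ∈
          Set.Icc 0 (1 / (1 - γ)) := fun k sa =>
        convex_combination_mem_Icc (hlam0 t) (hlam1 t) (ih k sa)
          (bellman_mem_Icc hγ0 hγ1 (hPpos k) (hPsum k) hR0 hR1 (ih k) sa)
      intro k sa
      rw [hQupd]
      split_ifs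
      · simpa [Finset.sum_apply] using average_mem_Icc hn fun k => hstep k sa
      · simpa using hstep k sa
  have hdrift : ∀ t : ℕ, ∃ t₀ : ℕ, t₀ ≤ t ∧ t < t₀ + E ∧ E ∣ t₀ ∧ ∀ j k sa,
      |Q t j sa - Q t k sa| ≤ ((t : ℝ) - t₀) * (2 / ((1 - γ) ^ 2 * (t₀ + E))) := by
    intro t
    induction t with
    | zero => exact ⟨0, le_rfl, by omega, dvd_zero _, fun j k sa => by simp [hQinit]⟩
    | succ t ih =>
      by_cases hd : E ∣ t + 1
      · exact ⟨t + 1, le_rfl, by omega, hd, fun j k sa => by simp [hQupd, hd]⟩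
      obtain ⟨t₀, h₁, h₂, h₃, h₄⟩ := ih
      have hne : t + 1 ≠ t₀ + E := fun h => hd (h ▸ h₃.add (dvd_refl E))
      refine ⟨t₀, by omega, by omega, h₃, fun j k sa => ?_⟩
      have hj := bellman_mem_Icc hγ0 hγ1 (hPpos j) (hPsum j) hR0 hR1 (hQrange t j) sa
      have hk := bellman_mem_Icc hγ0 hγ1 (hPpos k) (hPsum k) hR0 hR1 (hQrange t k) sa
      have hbell : |bellman γ R (P j) (Q t j) sa - bellman γ R (P k) (Q t k) sa| ≤
          1 / (1 - γ) :=
        abs_le.2 ⟨by linarith [hj.1, hk.2], by linarith [hj.2, hk.1]⟩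
      have hll : lam t * (1 / (1 - γ)) ≤ 2 / ((1 - γ) ^ 2 * (t₀ + E)) := by
        have hcast : (t₀ : ℝ) ≤ t := by exact_mod_cast h₁
        have := hτ t₀
        calc lam t * (1 / (1 - γ)) = 2 / ((1 - γ) ^ 2 * (t + E)) := by
              rw [hlam, div_mul_div_comm]
              ring_nf
          _ ≤ _ := by gcongr
      simp only [hQupd, hd, if_false, Pi.add_apply, Pi.smul_apply, smul_eq_mul]
      calc _ = |(1 - lam t) * (Q t j sa - Q t k sa) +
            lam t * (bellman γ R (P j) (Q t j) sa - bellman γ R (P k) (Q t k) sa)| := by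
            ring_nf
        _ ≤ (1 - lam t) * |Q t j sa - Q t k sa| +
            lam t * |bellman γ R (P j) (Q t j) sa - bellman γ R (P k) (Q t k) sa| := by
            refine (abs_add_le _ _).trans_eq ?_
            rw [abs_mul, abs_mul, abs_of_nonneg (hlam0 t),
              abs_of_nonneg (sub_nonneg.2 (hlam1 t))]
        _ ≤ |Q t j sa - Q t k sa| + lam t * (1 / (1 - γ)) := by
            refine add_le_add ?_ (mul_le_mul_of_nonneg_left hbell (hlam0 t))
            exact mul_le_of_le_one_left (abs_nonneg _) (by linarith [hlam0 t])
        _ ≤ _ := by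
            push_cast
            linarith [h₄ j k sa]
  have hspread : ∀ t j k sa, |Q t j sa - Q t k sa| ≤ 4 * E / ((1 - γ) ^ 2 * (t + E)) := by
    intro t j k sa
    obtain ⟨t₀, h₁, h₂, -, h₄⟩ := hdrift t
    have h₁' : (t₀ : ℝ) ≤ t := by exact_mod_cast h₁
    have h₂' : (t : ℝ) < t₀ + E := by exact_mod_cast h₂
    have := hτ t₀
    have := hτ t
    calc _ ≤ _ := h₄ j k sa
      _ ≤ E * (2 / ((1 - γ) ^ 2 * ((t + E) / 2))) := by
          gcongr
          · linarith
          · linarith [Nat.cast_nonneg (α := ℝ) t₀]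
      _ = _ := by
          field_simp
          ring
  have hbar : ∀ t sa, Qbar t sa = (1 / (n : ℝ)) * ∑ k, Q t k sa := fun t sa => by
    simp [hQbar, Finset.sum_apply]
  have hn0 : (n : ℝ) ≠ 0 := by positivity
  have hbarupd : ∀ t sa, Qbar (t + 1) sa = (1 - lam t) * Qbar t sa +
      lam t * ((1 / (n : ℝ)) * ∑ k, bellman γ R (P k) (Q t k) sa) := by
    intro t sa
    have hloc : Qbar (t + 1) sa = (1 / (n : ℝ)) *
        ∑ k, ((1 - lam t) * Q t k sa + lam t * bellman γ R (P k) (Q t k) sa) := by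
      rw [hbar]
      by_cases hd : E ∣ t + 1
      · simp [hQupd, hd, Finset.sum_apply, hn0]
      · simp [hQupd, hd]
    rw [hloc, hbar, Finset.sum_add_distrib, ← Finset.mul_sum, ← Finset.mul_sum]
    ring
  have hmain : ∀ (t : ℕ) sa,
      |Qbar t sa - Qstar sa| ≤ 16 * γ * E / ((1 - γ) ^ 3 * ((t : ℝ) + E)) := by
    intro t
    induction t with
    | zero =>
      intro sa
      have hs := average_bellman_fixed_mem_Icc hγ0 hγ1 hn hR0 hR1 hPpos hPsum hfix sa
      have hq : Qbar 0 sa ∈ Set.Icc 0 (1 / (1 - γ)) := by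
        rw [hbar]
        exact average_mem_Icc hn fun k => hQrange 0 k sa
      have hC : 1 / (1 - γ) ≤ 16 * γ * E / ((1 - γ) ^ 3 * (((0 : ℕ) : ℝ) + E)) := by
        rw [Nat.cast_zero, zero_add, mul_div_mul_right _ _ hE0.ne',
          div_le_div_iff₀ hg (by positivity)]
        nlinarith
      exact abs_le.2 ⟨by linarith [hs.2, hq.1], by linarith [hs.1, hq.2]⟩
    | succ t ih =>
      intro sa
      set C := 16 * γ * E / ((1 - γ) ^ 3 * ((t : ℝ) + E)) with hC
      set B := 4 * E / ((1 - γ) ^ 2 * ((t : ℝ) + E)) with hB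
      have hlocal : ∀ k sa, |Q t k sa - Qstar sa| ≤ C + B := by
        intro k sa
        have h₁ : |Qbar t sa - Q t k sa| ≤ B := by
          rw [hbar]
          exact abs_average_sub_le hn fun j => hspread t j k sa
        rw [abs_sub_comm] at h₁
        linarith [abs_sub_le (Q t k sa) (Qbar t sa) (Qstar sa), ih sa]
      have hTbar : |(1 / (n : ℝ)) * ∑ k, bellman γ R (P k) (Q t k) sa - Qstar sa| ≤
          γ * (C + B) := by
        have : (1 / (n : ℝ)) * ∑ k, bellman γ R (P k) (Q t k) sa - Qstar sa =
            (1 / (n : ℝ)) * ∑ k, (bellman γ R (P k) (Q t k) sa -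
              bellman γ R (P k) Qstar sa) - 0 := by
          rw [Finset.sum_sub_distrib, mul_sub, ← hfix sa, sub_zero]
        rw [this]
        exact abs_average_sub_le hn fun k => by
          rw [sub_zero]
          exact abs_bellman_sub_le hγ0 (hPpos k) (hPsum k) (hlocal k) sa
      calc |Qbar (t + 1) sa - Qstar sa|
          = |(1 - lam t) * (Qbar t sa - Qstar sa) + lam t *
            ((1 / (n : ℝ)) * ∑ k, bellman γ R (P k) (Q t k) sa - Qstar sa)| := by
            rw [hbarupd]
            ring_nf
        _ ≤ (1 - lam t) * |Qbar t sa - Qstar sa| + lam t *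
            |(1 / (n : ℝ)) * ∑ k, bellman γ R (P k) (Q t k) sa - Qstar sa| := by
            refine (abs_add_le _ _).trans_eq ?_
            rw [abs_mul, abs_mul, abs_of_nonneg (hlam0 t),
              abs_of_nonneg (sub_nonneg.2 (hlam1 t))]
        _ ≤ (1 - lam t) * C + lam t * (γ * (C + B)) :=
            add_le_add (mul_le_mul_of_nonneg_left (ih sa) (sub_nonneg.2 (hlam1 t)))
              (mul_le_mul_of_nonneg_left hTbar (hlam0 t))
        _ ≤ _ := by
            rw [hlam, hC, hB]
            refine (inverse_rate_step hγ0 hγ1 hE0.le (hτ t)).trans_eq ?_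
            push_cast
            ring_nf
  intro t
  have hCt : 0 ≤ 16 * γ * E / ((1 - γ) ^ 3 * ((t : ℝ) + E)) := by
    have := hτ t
    positivity
  exact (pi_norm_le_iff_of_nonneg hCt).2 fun sa => by simpa using hmain t sa
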